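/- arXiv:1107.1413 — 2 statements merged into one kernel-verified Lean document; each statement's English description precedes it below -/
import Mathlib

section
/- Let q = p^r be a prime power and let k be a field of characteristic different from p such that the polynomial x^{q−1} − 1 has q−1 distinct roots in k. Then the effective dimension over k of the multiplicative monoid Mat_{n×n}(F_q) of all n×n matrices over the field with q elements equals (qⁿ − 1)/(q − 1). -/
open scoped LinearAlgebra.Projectivization

/-- If `v₀` is not a multiple of `v`, some `u` has `u ⬝ v₀ = 1` and `u ⬝ v = 0`. -/
lemma aux_exists_dual {F : Type*} [Field F] {n : ℕ} (v₀ v : Fin n → F)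
    (h : v₀ ∉ Submodule.span F {v}) : ∃ u : Fin n → F, u ⬝ᵥ v₀ = 1 ∧ u ⬝ᵥ v = 0 := by
  obtain ⟨f, hf, hk⟩ := Submodule.exists_le_ker_of_notMem h
  have key : ∀ x : Fin n → F, (fun j => (f v₀)⁻¹ * f (Pi.single j 1)) ⬝ᵥ x = (f v₀)⁻¹ * f x := by
    intro x
    rw [LinearMap.pi_apply_eq_sum_univ f x, Finset.mul_sum]
    refine Finset.sum_congr rfl fun j _ => ?_
    have : (fun j_1 => if j = j_1 then (1 : F) else 0) = Pi.single j 1 := by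
      ext i; simp [Pi.single_apply, eq_comm]
    simp only [smul_eq_mul, this]; ring
  refine ⟨_, (key v₀).trans (inv_mul_cancel₀ hf), (key v).trans ?_⟩
  have : f v = 0 := hk (Submodule.mem_span_singleton_self v)
  simp [this]

lemma aux_translate {F : Type*} [Field F] [Fintype F] [DecidableEq F] {n : ℕ}
    {V : Type*} [AddCommMonoid V] (v₀ u₁ : Fin n → F) (h : u₁ ⬝ᵥ v₀ = 1)
    (g : (Fin n → F) → V) (hg : ∀ u, g (u + u₁) = g u) :
    ∑ u with u ⬝ᵥ v₀ = 1, g u = ∑ u with u ⬝ᵥ v₀ = 0, g u := by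
  symm
  refine Finset.sum_bij (fun u _ => u + u₁) ?_ ?_ ?_ ?_
  · intro u hu
    simp at hu
    simp [add_dotProduct, hu, h]
  · intro a _ b _ hab
    exact add_right_cancel hab
  · intro b hb
    simp at hb
    exact ⟨b - u₁, by simp [sub_dotProduct, hb, h], by simp⟩
  · intro u _
    exact (hg u).symm

lemma aux_card_dvd {F : Type*} [Field F] [Fintype F] [DecidableEq F] {n : ℕ}
    (v₀ u₁ : Fin n → F) (h : u₁ ⬝ᵥ v₀ = 1) :
    (Finset.univ.filter fun u : Fin n → F => u ⬝ᵥ v₀ = 1).card ∣ Fintype.card F ^ n := by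
  have h1 := aux_translate v₀ u₁ h (fun _ => (1 : ℕ)) (fun _ => rfl)
  simp only [Finset.sum_const, smul_eq_mul, mul_one] at h1
  let f : (Fin n → F) →+ F := AddMonoidHom.mk' (fun u => u ⬝ᵥ v₀) (fun a b => add_dotProduct a b v₀)
  have h2 := AddSubgroup.card_addSubgroup_dvd_card f.ker
  have h3 : Nat.card f.ker = (Finset.univ.filter fun u : Fin n → F => u ⬝ᵥ v₀ = 0).card := by
    rw [← Fintype.card_subtype, ← Nat.card_eq_fintype_card]
    rfl
  rw [h1, ← h3]
  simpa using h2

lemma aux_linInd {k V ι : Type*} [Field k] [AddCommGroup V] [Module k V]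
    (x : ι → V) (T : ι → V →ₗ[k] V) (hne : ∀ i, T i (x i) ≠ 0)
    (h0 : ∀ i j, i ≠ j → T i (x j) = 0) : LinearIndependent k x := by
  classical
  rw [linearIndependent_iff']
  intro s g hs i hi
  have := congrArg (T i) hs
  rw [map_sum, map_zero, Finset.sum_eq_single i] at this
  · rw [map_smul] at this
    exact (smul_eq_zero.mp this).resolve_right (hne i)
  · intro j _ hj
    rw [map_smul, h0 i j hj.symm, smul_zero]
  · exact fun h => absurd hi h

lemma aux_lower {F k : Type*} [Field F] [Fintype F] [Field k] {n m : ℕ}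
    (hF : ((Fintype.card F : ℕ) : k) ≠ 0) (i₀ : Fin n)
    (ψ : Matrix (Fin n) (Fin n) F → Matrix (Fin m) (Fin m) k)
    (hinj : Function.Injective ψ) (h0 : ψ 0 = 0) (hmul : ∀ s t, ψ (s * t) = ψ s * ψ t) :
    Nat.card (ℙ F (Fin n → F)) ≤ m := by
  classical
  have : Finite (ℙ F (Fin n → F)) := (Projectivization.finite_iff_of_finite _ _).2 inferInstance
  have : Fintype (ℙ F (Fin n → F)) := Fintype.ofFinite _
  let e : Fin n → F := Pi.single i₀ 1
  let E : Matrix (Fin n) (Fin n) F := Matrix.vecMulVec e e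
  have hE : E ≠ 0 := by
    intro h
    have := congrFun (congrFun h i₀) i₀
    simp [E, e, Matrix.vecMulVec_apply] at this
  have hψE : ψ E ≠ 0 := fun h => hE (hinj (h.trans h0.symm))
  obtain ⟨w₀, hw⟩ : ∃ w₀, (ψ E).mulVec w₀ ≠ 0 := by
    by_contra! hc
    exact hψE (Matrix.mulVec_injective (funext fun w => by simp [hc w]))
  let G : F → (Fin m → k) := fun a => (ψ (a • E)).mulVec w₀
  let T : ℙ F (Fin n → F) → (Fin m → k) →ₗ[k] (Fin m → k) := fun i =>
    ∑ u with u ⬝ᵥ i.rep = 1, (ψ (Matrix.vecMulVec e u)).mulVecLin -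
    ∑ u with u ⬝ᵥ i.rep = 0, (ψ (Matrix.vecMulVec e u)).mulVecLin
  let x : ℙ F (Fin n → F) → (Fin m → k) := fun i => (ψ (Matrix.vecMulVec i.rep e)).mulVec w₀
  have hT : ∀ i j, T i (x j) = ∑ u with u ⬝ᵥ i.rep = 1, G (u ⬝ᵥ j.rep) -
      ∑ u with u ⬝ᵥ i.rep = 0, G (u ⬝ᵥ j.rep) := by
    intro i j
    simp only [T, x, G, LinearMap.sub_apply, LinearMap.sum_apply, Matrix.mulVecLin_apply,
      Matrix.mulVec_mulVec, ← hmul, Matrix.vecMulVec_mul_vecMulVec, E, Matrix.vecMulVec_smul]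
  have hli : LinearIndependent k x := by
    refine aux_linInd x T ?_ ?_
    · intro i
      obtain ⟨u₁, hu₁, -⟩ := aux_exists_dual i.rep 0 (by simpa using i.rep_nonzero)
      rw [hT]
      have e1 : ∑ u with u ⬝ᵥ i.rep = 1, G (u ⬝ᵥ i.rep) = ∑ u with u ⬝ᵥ i.rep = 1, G 1 :=
        Finset.sum_congr rfl fun u hu => by rw [(Finset.mem_filter.1 hu).2]
      have e0 : ∑ u with u ⬝ᵥ i.rep = 0, G (u ⬝ᵥ i.rep) = 0 :=
        Finset.sum_eq_zero fun u hu => by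
          rw [(Finset.mem_filter.1 hu).2]; simp [G, h0]
      rw [e1, e0, sub_zero, Finset.sum_const, ← Nat.cast_smul_eq_nsmul k]
      refine smul_ne_zero ?_ (by simpa [G] using hw)
      obtain ⟨c, hc⟩ := aux_card_dvd i.rep u₁ hu₁
      intro hz
      have := congrArg (Nat.cast : ℕ → k) hc
      rw [Nat.cast_pow, Nat.cast_mul, hz, zero_mul] at this
      exact pow_ne_zero n hF this
    · intro i j hij
      obtain ⟨u₁, hu₁, hu₂⟩ := aux_exists_dual i.rep j.rep (by
        intro h
        obtain ⟨a, ha⟩ := Submodule.mem_span_singleton.1 h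
        apply hij
        rw [← i.mk_rep, ← j.mk_rep, Projectivization.mk_eq_mk_iff']
        exact ⟨a, ha⟩)
      rw [hT, sub_eq_zero]
      exact aux_translate _ u₁ hu₁ _ fun u => by rw [add_dotProduct, hu₂, add_zero]
  have := hli.fintype_card_le_finrank
  rw [Nat.card_eq_fintype_card]
  simpa using this

lemma aux_char {F k : Type*} [Field F] [Fintype F] [Field k]
    (hroots : ∃ s : Finset k, s.card = Fintype.card F - 1 ∧
      ∀ x ∈ s, x ^ (Fintype.card F - 1) = 1) :
    ∃ χ : F → k, Function.Injective χ ∧ χ 0 = 0 ∧ ∀ a b, χ (a * b) = χ a * χ b := by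
  classical
  obtain ⟨s, hs, hs1⟩ := hroots
  have hpos : 0 < Fintype.card F - 1 := by
    have := Fintype.one_lt_card (α := F); omega
  have : NeZero (Fintype.card F - 1) := ⟨hpos.ne'⟩
  have hle : Fintype.card F - 1 ≤ Nat.card (rootsOfUnity (Fintype.card F - 1) k) := by
    have hc : Nat.card s = Fintype.card F - 1 := by simp [hs]
    refine hc.symm.le.trans ?_
    refine Nat.card_le_card_of_injective
      (fun x : s => rootsOfUnity.mkOfPowEq x.1 (hs1 x.1 x.2)) ?_
    intro a b hab
    have := congrArg (fun z : rootsOfUnity (Fintype.card F - 1) k => ((z : kˣ) : k)) hab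
    exact Subtype.ext (by simpa using this)
  have hcard : Nat.card Fˣ = Nat.card (rootsOfUnity (Fintype.card F - 1) k) := by
    rw [Nat.card_eq_fintype_card, Fintype.card_units]
    refine le_antisymm hle ?_
    exact card_rootsOfUnity k _
  let e := mulEquivOfCyclicCardEq hcard
  refine ⟨fun a => if h : a = 0 then 0 else ((e (Units.mk0 a h) : kˣ) : k), ?_, by simp, ?_⟩
  · intro a b hab
    by_cases ha : a = 0 <;> by_cases hb : b = 0
    · rw [ha, hb]
    · simp only [ha, hb, dite_true, dite_false] at hab
      exact absurd hab.symm (Units.ne_zero _)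
    · simp only [ha, hb, dite_true, dite_false] at hab
      exact absurd hab (Units.ne_zero _)
    · simp only [ha, hb, dite_false] at hab
      have := e.injective (Subtype.ext (Units.ext hab))
      simpa using congrArg Units.val this
  · intro a b
    by_cases ha : a = 0
    · simp [ha]
    by_cases hb : b = 0
    · simp [hb]
    have hab := mul_ne_zero ha hb
    simp only [ha, hb, hab, dite_false, Units.mk0_mul, map_mul]
    simp

lemma aux_upper {F k : Type*} [Field F] [Fintype F] [Field k] (n : ℕ)
    (χ : F → k) (hχ : Function.Injective χ) (hχ0 : χ 0 = 0)
    (hχm : ∀ a b, χ (a * b) = χ a * χ b) :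
    ∃ φ : Matrix (Fin n) (Fin n) F → Matrix (Fin (Nat.card (ℙ F (Fin n → F))))
        (Fin (Nat.card (ℙ F (Fin n → F)))) k,
        Function.Injective φ ∧
        ∀ s t : Matrix (Fin n) (Fin n) F, φ (s * t) = φ s * φ t := by
  classical
  have : Finite (ℙ F (Fin n → F)) := (Projectivization.finite_iff_of_finite _ _).2 inferInstance
  have : Fintype (ℙ F (Fin n → F)) := Fintype.ofFinite _
  let P := ℙ F (Fin n → F)
  let eq : P ≃ Fin (Nat.card P) := Finite.equivFin P
  have hχ1 : χ 1 = 1 := by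
    have h1 := hχm 1 1
    rw [mul_one] at h1
    have h2 : χ 1 ≠ 0 := fun h => one_ne_zero (hχ (h.trans hχ0.symm))
    exact (mul_left_cancel₀ h2 ((mul_one _).trans h1)).symm
  let δ : (Fin n → F) → P → k := fun x i => ∑ c : F, if x = c • i.rep then χ c else 0
  have hδ : ∀ (c : F) (j i : P), δ (c • j.rep) i = if i = j then χ c else 0 := by
    intro c j i
    by_cases hij : i = j
    · subst hij
      have : ∀ c', c • i.rep = c' • i.rep ↔ c' = c := fun c' =>
        ⟨fun h => (smul_left_injective F i.rep_nonzero h).symm, fun h => by rw [h]⟩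
      simp [δ, this]
    · rw [if_neg hij]
      refine Finset.sum_eq_zero fun c' _ => ?_
      split_ifs with h
      · by_cases hc' : c' = 0
        · rw [hc', hχ0]
        · exfalso
          apply hij
          rw [← i.mk_rep, ← j.mk_rep, Projectivization.mk_eq_mk_iff']
          refine ⟨c'⁻¹ * c, ?_⟩
          rw [mul_smul, h, smul_smul, inv_mul_cancel₀ hc', one_smul]
      · rfl
  have hrep : ∀ x : Fin n → F, x = 0 ∨ ∃ (c : F) (j : P), x = c • j.rep := by
    intro x
    by_cases hx : x = 0
    · exact Or.inl hx
    · right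
      obtain ⟨a, ha⟩ := Projectivization.exists_smul_eq_mk_rep F x hx
      refine ⟨((a⁻¹ : Fˣ) : F), Projectivization.mk F x hx, ?_⟩
      rw [← ha, Units.smul_def, smul_smul, Units.inv_mul, one_smul]
  have hδ0 : δ 0 = 0 := by
    ext i
    have := hδ 0 i i
    simpa [hχ0] using this
  have hδs : ∀ c x, δ (c • x) = χ c • δ x := by
    intro c x
    rcases hrep x with rfl | ⟨d, j, rfl⟩
    · simp [hδ0]
    · ext i
      rw [smul_smul, hδ, Pi.smul_apply, hδ, hχm]
      simp
  have hδi : Function.Injective δ := by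
    have key : ∀ (c d : F) (i j : P), δ (c • i.rep) = δ (d • j.rep) → c • i.rep = d • j.rep := by
      intro c d i j h
      have h1 := congrFun h i
      have h2 := congrFun h j
      rw [hδ, hδ] at h1 h2
      by_cases hij : i = j
      · subst hij
        simp only [if_true] at h1
        rw [hχ h1]
      · simp only [if_true, if_neg hij, if_neg (Ne.symm hij)] at h1 h2
        rw [hχ (h1.trans hχ0.symm), hχ (h2.symm.trans hχ0.symm), zero_smul, zero_smul]
    have key0 : ∀ (c : F) (i : P), δ (c • i.rep) = 0 → c • i.rep = 0 := by
      intro c i h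
      have := key c 0 i i (by rw [h, zero_smul, hδ0])
      simpa using this
    intro x y h
    rcases hrep x with rfl | ⟨c, i, rfl⟩ <;> rcases hrep y with rfl | ⟨d, j, rfl⟩
    · rfl
    · exact (key0 _ _ (by rw [← h, hδ0])).symm
    · exact key0 _ _ (by rw [h, hδ0])
    · exact key _ _ _ _ h
  let M : Matrix (Fin n) (Fin n) F → Matrix P P k := fun A =>
    Matrix.of fun i j => δ (A.mulVec j.rep) i
  have hMδ : ∀ A x, (M A).mulVec (δ x) = δ (A.mulVec x) := by
    intro A x
    rcases hrep x with rfl | ⟨c, j, rfl⟩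
    · simp [hδ0]
    · rw [Matrix.mulVec_smul, hδs c (A.mulVec j.rep)]
      ext i
      simp only [Matrix.mulVec, dotProduct, hδ, M, Matrix.of_apply]
      simp [mul_comm]
  have hMm : ∀ A B, M (A * B) = M A * M B := by
    intro A B
    ext i j
    have := congrFun (hMδ A (B.mulVec j.rep)) i
    rw [Matrix.mulVec_mulVec] at this
    exact this.symm
  have hMi : Function.Injective M := by
    intro A B h
    have h1 : ∀ j : P, A.mulVec j.rep = B.mulVec j.rep := by
      intro j
      apply hδi
      ext i
      exact congrFun (congrFun h i) j
    apply Matrix.mulVec_injective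
    ext1 x
    rcases hrep x with rfl | ⟨c, j, rfl⟩
    · simp
    · rw [Matrix.mulVec_smul, Matrix.mulVec_smul, h1]
  refine ⟨fun A => Matrix.reindex eq eq (M A), (Matrix.reindex eq eq).injective.comp hMi, ?_⟩
  intro A B
  simp only [Matrix.reindex_apply, hMm]
  rw [Matrix.submatrix_mul_equiv]

/-- Let `q = p^r` be a prime power and `k` a field of characteristic different
from `p` in which the polynomial `x^(q-1) - 1` has `q - 1` distinct roots.
Then the effective dimension over `k` of the multiplicative monoid of `n × n`
matrices over the field with `q` elements is `(q^n - 1)/(q - 1)`. -/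
theorem effDim_matrix_monoid_over_finite_field
    (p r : ℕ) (hp : p.Prime) (hr : 0 < r) (q : ℕ) (hq : q = p ^ r)
    (k : Type*) [Field k] (hchar : ringChar k ≠ p)
    (hroots : ∃ s : Finset k, s.card = q - 1 ∧ ∀ x ∈ s, x ^ (q - 1) = 1)
    (F : Type*) [Field F] [Fintype F] (hF : Fintype.card F = q)
    (n : ℕ) :
    IsLeast {m : ℕ | ∃ φ : Matrix (Fin n) (Fin n) F → Matrix (Fin m) (Fin m) k,
        Function.Injective φ ∧
        ∀ s t : Matrix (Fin n) (Fin n) F, φ (s * t) = φ s * φ t}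
      ((q ^ n - 1) / (q - 1)) := by
  subst hF
  have hcardP : Nat.card (ℙ F (Fin n → F)) =
      (Fintype.card F ^ n - 1) / (Fintype.card F - 1) := by
    rw [Projectivization.card'']
    simp
  rw [← hcardP]
  constructor
  · obtain ⟨χ, h1, h2, h3⟩ := aux_char hroots
    exact aux_upper n χ h1 h2 h3
  · rintro m ⟨φ, hinj, hmul⟩
    rcases Nat.eq_zero_or_pos n with rfl | hn
    · rw [hcardP]; simp
    have hpk : (p : k) ≠ 0 := by
      intro h
      have hd := (ringChar.spec k p).1 h
      rcases (Nat.dvd_prime hp).1 hd with h1 | h1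
      · exact CharP.ringChar_ne_one h1
      · exact hchar h1
    refine aux_lower (by rw [hq, Nat.cast_pow]; exact pow_ne_zero _ hpk) ⟨0, hn⟩
      (fun A => φ A - φ 0) ?_ (sub_self _) ?_
    · intro A B h
      exact hinj (sub_left_injective h)
    · intro A B
      simp only [sub_mul, mul_sub, ← hmul, mul_zero, zero_mul]
      abel
end

section
/- Let N be a finite nilpotent semigroup with zero element z (so z·s = s·z = z for all s, and every sufficiently long product equals z) satisfying: (i) N acts by partial injective maps on the left of N∖{z}, i.e. for all s, a, b ∈ N with a ≠ z, b ≠ z, if s·a = s·b and s·a ≠ z then a = b; and (ii) there is a unique element w ∈ N∖{z} with s·w = z for all s ∈ N. Then for every field k the effective dimension of N over k equals |N|. -/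
open Matrix in
/-- Independence of the vectors `ψ a v`, `a ≠ z`. -/
lemma aux_indep {N : Type*} [Semigroup N] [Fintype N] (z : N)
    (hz : ∀ s : N, z * s = z ∧ s * z = z)
    (hinjact : ∀ s a b : N, a ≠ z → b ≠ z → s * a = s * b → s * a ≠ z → a = b)
    (w : N) (hw : ∀ y : N, (y ≠ z ∧ ∀ s : N, s * y = z) → y = w)
    {k : Type*} [Field k] {m : ℕ} (ψ : N → Matrix (Fin m) (Fin m) k)
    (hψ : ∀ s t, ψ (s * t) = ψ s * ψ t) (hψz : ψ z = 0) (v : Fin m → k)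
    (hv : ψ w *ᵥ v ≠ 0) (n : ℕ) :
    ∀ c : N → k,
      (∀ a, a ≠ z → c a ≠ 0 → ∀ L : List N, L.length = n → L.foldr (· * ·) a = z) →
      ∑ a, c a • (ψ a *ᵥ v) = 0 → ∀ a, a ≠ z → c a = 0 := by
  classical
  induction n with
  | zero =>
    intro c h _ a ha
    by_contra hc
    exact ha (h a ha hc [] rfl)
  | succ n ih =>
    intro c h hsum
    have key : ∀ a, a ≠ z → c a ≠ 0 → a = w := by
      intro a ha hc
      refine hw a ⟨ha, fun s => ?_⟩
      by_contra hsa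
      have h1 := ih (fun b => ∑ x with s * x = b, c x) ?_ ?_ (s * a) hsa
      · apply hc
        rw [← h1, Finset.sum_eq_single a]
        · intro x hx hxa
          rw [Finset.mem_filter] at hx
          by_cases hxz : x = z
          · subst hxz
            exact absurd (hx.2.symm.trans (hz s).2) hsa
          · exact absurd (hinjact s a x ha hxz hx.2.symm hsa).symm hxa
        · intro hx
          simp at hx
      · intro b hb hcb L hL
        obtain ⟨x, hx, hcx⟩ := Finset.exists_ne_zero_of_sum_ne_zero hcb
        rw [Finset.mem_filter] at hx
        have hxz : x ≠ z := by
          rintro rfl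
          exact hb (hx.2.symm.trans (hz s).2)
        have := h x hxz hcx (L ++ [s]) (by simp [hL])
        rw [List.foldr_append] at this
        simpa [hx.2] using this
      · have h2 : ψ s *ᵥ (∑ a, c a • (ψ a *ᵥ v)) = 0 := by rw [hsum, mulVec_zero]
        rw [Matrix.mulVec_sum] at h2
        rw [← h2]
        rw [← Finset.sum_fiberwise (s := Finset.univ) (g := fun x => s * x)
          (f := fun i => ψ s *ᵥ (c i • (ψ i *ᵥ v)))]
        refine Finset.sum_congr rfl fun b _ => ?_
        rw [Finset.sum_smul]
        refine Finset.sum_congr rfl fun x hx => ?_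
        rw [Finset.mem_filter] at hx
        rw [mulVec_smul, mulVec_mulVec, ← hψ, hx.2]
    intro a ha
    by_contra hc
    have haw := key a ha hc
    subst haw
    rw [Finset.sum_eq_single a] at hsum
    · exact (smul_ne_zero hc hv) hsum
    · intro b _ hb
      by_cases hbz : b = z
      · simp [hbz, hψz]
      · by_cases hcb : c b = 0
        · simp [hcb]
        · exact absurd (key b hbz hcb) hb
    · simp

lemma aux_foldr {N : Type*} [Semigroup N] (a : N) (L : List N) (s : N) :
    (s :: L).foldr (· * ·) a = (L ++ [a]).foldl (· * ·) s := by
  induction L generalizing s with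
  | nil => simp
  | cons t L ih =>
    rw [List.foldr_cons, ih t]
    simp only [List.cons_append, List.foldl_cons]
    exact (List.foldl_assoc).symm

/-- Let `N` be a finite nilpotent semigroup with zero `z` such that (i) `N`
acts by partial injective maps on the left of `N \ {z}` and (ii) there is a
unique element `w ≠ z` with `N·w = {z}`.  Then the effective dimension of `N`
over any field equals `|N|`. -/
theorem effDim_eq_card_of_partial_injective_nilpotent
    {N : Type*} [Semigroup N] [Fintype N] (z : N)
    (hz : ∀ s : N, z * s = z ∧ s * z = z)
    (hnil : ∃ n : ℕ, ∀ f : Fin (n + 1) → N,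
      (List.ofFn fun i : Fin n => f i.succ).foldl (· * ·) (f 0) = z)
    (hinjact : ∀ s a b : N, a ≠ z → b ≠ z → s * a = s * b → s * a ≠ z → a = b)
    (hw : ∃! w : N, w ≠ z ∧ ∀ s : N, s * w = z)
    (k : Type*) [Field k] :
    IsLeast {m : ℕ | ∃ φ : N → Matrix (Fin m) (Fin m) k,
        Function.Injective φ ∧ ∀ s t : N, φ (s * t) = φ s * φ t}
      (Fintype.card N) := by
  classical
  obtain ⟨n, hn⟩ := hnil
  obtain ⟨w, ⟨hwz, hwk⟩, hwu⟩ := hw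
  have hfold : ∀ (s : N) (L : List N), L.length = n → L.foldl (· * ·) s = z := by
    intro s L hL
    subst hL
    have := hn (Fin.cons s L.get)
    simpa using this
  constructor
  · let o : N → N → N := fun s b => if b = z then s else s * b
    have ho : ∀ s t b, o (s * t) b = if o t b = z then z else o s (o t b) := by
      intro s t b
      by_cases hb : b = z
      · by_cases ht : t = z
        · simp [o, hb, ht, (hz s).2]
        · simp [o, hb, ht]
      · by_cases ht : t * b = z
        · simp [o, hb, ht, mul_assoc, (hz s).2]
        · simp [o, hb, ht, mul_assoc]
    let M : N → Matrix N N k := fun s => Matrix.of fun a b => if a ≠ z ∧ a = o s b then 1 else 0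
    have hM : ∀ s t, M (s * t) = M s * M t := by
      intro s t
      ext a b
      rw [Matrix.mul_apply, Finset.sum_eq_single (o t b)]
      · simp only [M, Matrix.of_apply, ho]
        by_cases h : o t b = z
        · simp [h]
        · simp [h]
      · intro c _ hc
        simp [M, hc]
      · simp
    have hMi : Function.Injective M := by
      have hh : ∀ s t, M s = M t → s ≠ z → s = t := by
        intro s t h hs
        have := congrFun (congrFun h s) z
        simp only [M, o, Matrix.of_apply] at this
        by_contra hst
        simp [hs, hst] at this
      intro s t h
      by_cases hs : s = z
      · by_cases ht : t = z
        · rw [hs, ht]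
        · exact (hh t s h.symm ht).symm
      · exact hh s t h hs
    let e := Fintype.equivFin N
    refine ⟨fun s => Matrix.reindexAlgEquiv k k e (M s), ?_, ?_⟩
    · exact (Matrix.reindexAlgEquiv k k e).injective.comp hMi
    · intro s t
      simp only [hM, map_mul]
  · rintro m ⟨φ, hφi, hφ⟩
    let ψ : N → Matrix (Fin m) (Fin m) k := fun s => φ s - φ z
    have hψ : ∀ s t, ψ (s * t) = ψ s * ψ t := by
      intro s t
      simp only [ψ, mul_sub, sub_mul, ← hφ, (hz _).1, (hz _).2]
      abel
    have hψz : ψ z = 0 := by simp [ψ]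
    have hψw : ψ w ≠ 0 := fun h => hwz (hφi (sub_eq_zero.mp h))
    obtain ⟨v, hv⟩ : ∃ v, Matrix.mulVec (ψ w) v ≠ 0 := by
      by_contra! h
      apply hψw
      apply Matrix.ext_of_mulVec_single
      intro i
      rw [h, Matrix.zero_mulVec]
    have hind : ∀ c : N → k, ∑ a, c a • (Matrix.mulVec (ψ a) v) = 0 → ∀ a, a ≠ z → c a = 0 := by
      intro c
      refine aux_indep z hz hinjact w hwu ψ hψ hψz v hv (n + 1) c ?_
      intro a _ _ L hL
      cases L with
      | nil => simp at hL
      | cons s L =>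
        rw [aux_foldr, List.foldl_append, hfold s L (by simpa using hL)]
        simp [(hz a).1]
    have hwa : ∀ a, w * a ≠ w := by
      intro a h
      have h1 : ∀ j, (List.replicate j a).foldl (· * ·) w = w := by
        intro j
        induction j with
        | zero => rfl
        | succ j ih => rw [List.replicate_succ, List.foldl_cons, h, ih]
      exact hwz ((h1 n).symm.trans (hfold w _ (by simp)))
    let u : N → (Fin m → k) := fun a => if a = z then v else Matrix.mulVec (ψ a) v
    have hu : LinearIndependent k u := by
      rw [Fintype.linearIndependent_iff]
      intro g hg
      have hsplit : g z • v + ∑ a, g a • (Matrix.mulVec (ψ a) v) = 0 := by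
        rw [← hg, ← Finset.add_sum_erase _ _ (Finset.mem_univ z),
          ← Finset.add_sum_erase _ (fun i => g i • u i) (Finset.mem_univ z)]
        simp only [hψz, Matrix.zero_mulVec, smul_zero, zero_add, u, if_true]
        congr 1
        refine Finset.sum_congr rfl fun x hx => ?_
        rw [if_neg (Finset.ne_of_mem_erase hx)]
      have hgz : g z = 0 := by
        have h1 := hind (fun b => (if b = w then g z else 0) + ∑ x with w * x = b, g x) ?_ w hwz
        · rw [Finset.sum_eq_zero] at h1
          · simpa using h1
          · intro x hx
            rw [Finset.mem_filter] at hx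
            exact absurd hx.2 (hwa x)
        · have h2 := congrArg (Matrix.mulVec (ψ w)) hsplit
          rw [Matrix.mulVec_zero, Matrix.mulVec_add, Matrix.mulVec_sum, Matrix.mulVec_smul] at h2
          rw [← h2]
          simp only [add_smul, Finset.sum_add_distrib]
          congr 1
          · simp
          · rw [← Finset.sum_fiberwise (s := Finset.univ) (g := fun x => w * x)
              (f := fun i => Matrix.mulVec (ψ w) (g i • (Matrix.mulVec (ψ i) v)))]
            refine Finset.sum_congr rfl fun b _ => ?_
            rw [Finset.sum_smul]
            refine Finset.sum_congr rfl fun x hx => ?_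
            rw [Finset.mem_filter] at hx
            rw [Matrix.mulVec_smul, Matrix.mulVec_mulVec, ← hψ, hx.2]
      intro a
      by_cases ha : a = z
      · rw [ha, hgz]
      · refine hind g ?_ a ha
        rw [hgz, zero_smul, zero_add] at hsplit
        exact hsplit
    simpa using hu.fintype_card_le_finrank
end
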